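/- arXiv:1211.2164 — 6 statements merged into one kernel-verified Lean document; each statement's English description precedes it below -/
import Mathlib

section
/- Let F : ℝ × ℝⁿ → (ℝⁿ →L ℝⁿ) and X : ℝ × ℝⁿ → ℝⁿ be continuously differentiable, and for each (t, p) let S(t,p) = (F(t,p) + F(t,p)*)/2 be the self-adjoint part of F(t,p) with respect to the Euclidean inner product. Assume: (i) for each T > 0 there is a constant N_T such that ‖S(t,p)‖ ≤ N_T (operator norm) for all t ∈ [−T, T] and all p ∈ ℝⁿ; (ii) for each T > 0 there are constants A_T, C_T > 0 such that ‖X(t,p)‖ ≤ A_T ‖p‖ + C_T for all t ∈ [−T, T] and all p ∈ ℝⁿ. Then for every (p, v) ∈ ℝⁿ × ℝⁿ there exists a twice continuously differentiable curve γ : ℝ → ℝⁿ with γ(0) = p, γ'(0) = v, and γ''(t) = F(t, γ(t))(γ'(t)) + X(t, γ(t)) for all t ∈ ℝ. -/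
/-- The self-adjoint part `(A + A*)/2` of a continuous linear operator on
Euclidean space, with respect to the Euclidean inner product. -/
noncomputable def selfAdjointPart' {n : ℕ}
    (A : EuclideanSpace ℝ (Fin n) →L[ℝ] EuclideanSpace ℝ (Fin n)) :
    EuclideanSpace ℝ (Fin n) →L[ℝ] EuclideanSpace ℝ (Fin n) :=
  (2⁻¹ : ℝ) • (A + ContinuousLinearMap.adjoint A)

open Set Metric Function in
theorem aux_gronwall_fwd {g g' : ℝ → ℝ} {K T : ℝ} (hK : 0 ≤ K) (hT : 0 < T)
    (hg0 : ∀ t, 0 ≤ g t)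
    (hg : ∀ t ∈ Icc (-T) T, HasDerivWithinAt g (g' t) (Icc (-T) T) t)
    (hb : ∀ t ∈ Icc (-T) T, |g' t| ≤ K * g t) :
    ∀ t ∈ Icc 0 T, g t ≤ g 0 * Real.exp (K * T) := by
  intro t ht
  have h := norm_le_gronwallBound_of_norm_deriv_right_le (f := g) (f' := g') (δ := g 0) (K := K)
    (ε := 0) (a := 0) (b := T)
    (fun x hx => ((hg x ⟨by linarith [hx.1], hx.2⟩).continuousWithinAt).mono
      (Icc_subset_Icc (by linarith) le_rfl))
    (fun x hx => (hg x ⟨by linarith [hx.1], hx.2.le⟩).mono_of_mem_nhdsWithin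
      (Filter.mem_of_superset (Icc_mem_nhdsGE hx.2)
        (Icc_subset_Icc (by linarith [hx.1]) le_rfl)))
    (by rw [Real.norm_eq_abs, abs_of_nonneg (hg0 0)])
    (fun x hx => by
      rw [Real.norm_eq_abs, Real.norm_eq_abs, abs_of_nonneg (hg0 x), add_zero]
      exact hb x ⟨by linarith [hx.1], hx.2.le⟩) t ht
  rw [gronwallBound_ε0, Real.norm_eq_abs, abs_of_nonneg (hg0 t), sub_zero] at h
  refine h.trans ?_
  have := hg0 0
  have := ht.2
  gcongr

open Set Metric Function in
theorem aux_gronwall {g g' : ℝ → ℝ} {K T : ℝ} (hK : 0 ≤ K) (hT : 0 < T)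
    (hg0 : ∀ t, 0 ≤ g t)
    (hg : ∀ t ∈ Icc (-T) T, HasDerivWithinAt g (g' t) (Icc (-T) T) t)
    (hb : ∀ t ∈ Icc (-T) T, |g' t| ≤ K * g t) :
    ∀ t ∈ Icc (-T) T, g t ≤ g 0 * Real.exp (K * T) := by
  intro t ht
  rcases le_total 0 t with h | h
  · exact aux_gronwall_fwd hK hT hg0 hg hb t ⟨h, ht.2⟩
  · have := aux_gronwall_fwd (g := fun s => g (-s)) (g' := fun s => -(g' (-s))) hK hT
      (fun s => hg0 _) (fun s hs => by
        have h1 : HasDerivWithinAt (fun s : ℝ => -s) (-1) (Icc (-T) T) s :=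
          (hasDerivAt_neg s).hasDerivWithinAt
        have hm : MapsTo (fun s : ℝ => -s) (Icc (-T) T) (Icc (-T) T) :=
          fun u hu => ⟨by linarith [hu.2], by linarith [hu.1]⟩
        have h2 := (hg (-s) (hm hs)).comp s h1 hm
        simpa [Function.comp_def] using h2)
      (fun s hs => by
        rw [abs_neg]; exact hb (-s) ⟨by linarith [hs.2], by linarith [hs.1]⟩)
      (-t) ⟨by linarith, by linarith [ht.1]⟩
    simpa using this

open Set Metric Function in
theorem aux_lipschitz {Z : Type*} [NormedAddCommGroup Z] [NormedSpace ℝ Z]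
    [FiniteDimensional ℝ Z] (Y : ℝ × Z → Z) (hY : ContDiff ℝ 1 Y) (T a : ℝ) (z : Z) :
    ∃ K : NNReal, ∀ t ∈ Icc (-T) T, LipschitzOnWith K (fun x => Y (t, x)) (closedBall z a) := by
  have : ProperSpace Z := FiniteDimensional.proper_real Z
  have hc : IsCompact (Icc (-T) T ×ˢ closedBall z a) :=
    isCompact_Icc.prod (isCompact_closedBall z a)
  obtain ⟨K, hK⟩ := (hY.locallyLipschitz.locallyLipschitzOn
    (s := Icc (-T) T ×ˢ closedBall z a)).exists_lipschitzOnWith_of_compact hc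
  refine ⟨K, fun t ht x hx y hy => ?_⟩
  have := hK (x := (t, x)) ⟨ht, hx⟩ (y := (t, y)) ⟨ht, hy⟩
  simpa [Prod.edist_eq] using this

open Set Metric Function in
theorem aux_local {Z : Type*} [NormedAddCommGroup Z] [NormedSpace ℝ Z]
    [FiniteDimensional ℝ Z] (Y : ℝ × Z → Z) (hY : ContDiff ℝ 1 Y) (z₀ : Z) (T : ℝ) (hT : 0 < T)
    (R : ℝ) (hR : 0 < R)
    (hap : ∀ φ : Z → ℝ, (∀ z, 0 ≤ φ z ∧ φ z ≤ 1) → ∀ α : ℝ → Z, α 0 = z₀ →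
      (∀ t ∈ Icc (-T) T, HasDerivWithinAt α (φ (α t) • Y (t, α t)) (Icc (-T) T) t) →
      ∀ t ∈ Icc (-T) T, ‖α t‖ ≤ R) :
    ∃ α : ℝ → Z, α 0 = z₀ ∧ ∀ t ∈ Ioo (-T) T, HasDerivAt α (Y (t, α t)) t ∧ ‖α t‖ ≤ R := by
  have : ProperSpace Z := FiniteDimensional.proper_real Z
  have : CompleteSpace Z := FiniteDimensional.complete ℝ Z
  let φ : ContDiffBump (0 : Z) := ⟨R, R + 1, hR, by linarith⟩
  let G : ℝ × Z → Z := fun p => φ p.2 • Y p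
  have hG : ContDiff ℝ 1 G := (φ.contDiff.comp contDiff_snd).smul hY
  have hc : IsCompact (Icc (-T) T ×ˢ closedBall (0 : Z) (R + 1)) :=
    isCompact_Icc.prod (isCompact_closedBall _ _)
  obtain ⟨L, hL⟩ := hc.exists_bound_of_continuousOn hG.continuous.continuousOn
  have hL' : ∀ t ∈ Icc (-T) T, ∀ x, ‖G (t, x)‖ ≤ L.toNNReal := by
    intro t ht x
    by_cases hx : x ∈ closedBall (0 : Z) (R + 1)
    · exact (hL (t, x) ⟨ht, hx⟩).trans (Real.le_coe_toNNReal L)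
    · have : φ x = 0 := φ.zero_of_le_dist (le_of_lt (by simpa using hx))
      simp [G, this]
  obtain ⟨K, hK⟩ := aux_lipschitz G hG T ((L.toNNReal * T.toNNReal : NNReal) : ℝ) z₀
  have h0 : (0 : ℝ) ∈ Icc (-T) T := ⟨by linarith, hT.le⟩
  have hPL : IsPicardLindelof (fun t x => G (t, x)) (⟨0, h0⟩ : Icc (-T) T) z₀
      (L.toNNReal * T.toNNReal) 0 L.toNNReal K :=
    { lipschitzOnWith := hK
      continuousOn := fun x _ => (hG.continuous.comp (by fun_prop)).continuousOn
      norm_le := fun t ht x _ => hL' t ht x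
      mul_max_le := by simp [hT.le] }
  obtain ⟨α, hα0, hα⟩ := hPL.exists_eq_forall_mem_Icc_hasDerivWithinAt₀
  have hb := hap φ (fun z => ⟨φ.nonneg, φ.le_one⟩) α hα0 hα
  refine ⟨α, hα0, fun t ht => ?_⟩
  have ht' := Ioo_subset_Icc_self ht
  have h1 : φ (α t) = 1 := φ.one_of_mem_closedBall (by simpa using hb t ht')
  have h2 := (hα t ht').hasDerivAt (Icc_mem_nhds ht.1 ht.2)
  simp only [G, h1, one_smul] at h2
  exact ⟨h2, hb t ht'⟩

open Set Metric Function in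
theorem aux_global {Z : Type*} [NormedAddCommGroup Z] [NormedSpace ℝ Z]
    [FiniteDimensional ℝ Z] (Y : ℝ × Z → Z) (hY : ContDiff ℝ 1 Y) (z₀ : Z)
    (hap : ∀ T > 0, ∃ R > 0, ∀ φ : Z → ℝ, (∀ z, 0 ≤ φ z ∧ φ z ≤ 1) → ∀ α : ℝ → Z, α 0 = z₀ →
      (∀ t ∈ Icc (-T) T, HasDerivWithinAt α (φ (α t) • Y (t, α t)) (Icc (-T) T) t) →
      ∀ t ∈ Icc (-T) T, ‖α t‖ ≤ R) :
    ∃ α : ℝ → Z, α 0 = z₀ ∧ ∀ t, HasDerivAt α (Y (t, α t)) t := by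
  have hex : ∀ n : ℕ, ∃ (R : ℝ) (α : ℝ → Z), α 0 = z₀ ∧
      ∀ t ∈ Ioo (-((n : ℝ) + 1)) (n + 1), HasDerivAt α (Y (t, α t)) t ∧ ‖α t‖ ≤ R := by
    intro n
    obtain ⟨R, hR, h⟩ := hap (n + 1) (by positivity)
    exact ⟨R, aux_local Y hY z₀ (n + 1) (by positivity) R hR h⟩
  choose R α hα0 hα using hex
  have huniq : ∀ m n : ℕ, m ≤ n → EqOn (α m) (α n) (Ioo (-((m : ℝ) + 1)) (m + 1)) := by
    intro m n hmn
    have hmn' : (m : ℝ) ≤ n := by exact_mod_cast hmn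
    obtain ⟨K, hK⟩ := aux_lipschitz Y hY (m + 1) (max (R m) (R n)) 0
    refine ODE_solution_unique_of_mem_Ioo (v := fun t x => Y (t, x))
      (s := fun _ => closedBall 0 (max (R m) (R n))) (K := K) (t₀ := 0)
      (fun t ht => hK t (Ioo_subset_Icc_self ht)) ⟨by linarith [m.cast_nonneg (α := ℝ)], by positivity⟩
      (fun t ht => ⟨(hα m t ht).1, ?_⟩) (fun t ht => ?_) (by rw [hα0, hα0])
    · simpa using Or.inl (hα m t ht).2
    · have ht' : t ∈ Ioo (-((n : ℝ) + 1)) (n + 1) := ⟨by linarith [ht.1], by linarith [ht.2]⟩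
      exact ⟨(hα n t ht').1, by simpa using Or.inr (hα n t ht').2⟩
  have hmem : ∀ t : ℝ, ∀ k : ℕ, |t| ≤ k → t ∈ Ioo (-((k : ℝ) + 1)) (k + 1) := by
    intro t k hk
    have := abs_le.mp hk
    exact ⟨by linarith [this.1], by linarith [this.2]⟩
  let β : ℝ → Z := fun t => α ⌈|t|⌉₊ t
  have hβ : ∀ n : ℕ, ∀ t ∈ Ioo (-((n : ℝ) + 1)) (n + 1), β t = α n t := by
    intro n t ht
    rcases le_total ⌈|t|⌉₊ n with h | h
    · exact huniq _ _ h (hmem t _ (Nat.le_ceil _))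
    · exact (huniq _ _ h ht).symm
  refine ⟨β, by simp [β, hα0], fun t => ?_⟩
  have ht := hmem t _ (Nat.le_ceil |t|)
  have h1 := (hα _ t ht).1
  rw [← hβ _ t ht] at h1
  exact h1.congr_of_eventuallyEq (Filter.eventually_of_mem (Ioo_mem_nhds ht.1 ht.2) (hβ _))

theorem aux_inner {n : ℕ} (A : EuclideanSpace ℝ (Fin n) →L[ℝ] EuclideanSpace ℝ (Fin n))
    (v : EuclideanSpace ℝ (Fin n)) :
    |inner ℝ v (A v)| ≤ ‖selfAdjointPart' A‖ * ‖v‖ ^ 2 := by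
  have h : inner ℝ v (A v) = inner ℝ v (selfAdjointPart' A v) := by
    simp only [selfAdjointPart', ContinuousLinearMap.smul_apply, ContinuousLinearMap.add_apply,
      inner_smul_right, inner_add_right, ContinuousLinearMap.adjoint_inner_right]
    rw [real_inner_comm v (A v)]
    ring
  rw [h]
  calc _ ≤ ‖v‖ * ‖selfAdjointPart' A v‖ := abs_real_inner_le_norm _ _
    _ ≤ ‖v‖ * (‖selfAdjointPart' A‖ * ‖v‖) := by gcongr; exact ContinuousLinearMap.le_opNorm _ _
    _ = _ := by ring

/-- Theorem 2 on `ℝⁿ`: if the self-adjoint part of `F` is bounded along finite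
times and `X` grows at most linearly along finite times, then every
inextensible solution of `γ'' = F(t,γ)(γ') + X(t,γ)` is complete, i.e. for
every initial condition there is a globally defined solution. -/
theorem completeness_bounded_S_linear_X {n : ℕ}
    (F : ℝ × EuclideanSpace ℝ (Fin n) →
      (EuclideanSpace ℝ (Fin n) →L[ℝ] EuclideanSpace ℝ (Fin n)))
    (hF : ContDiff ℝ 1 F)
    (X : ℝ × EuclideanSpace ℝ (Fin n) → EuclideanSpace ℝ (Fin n))
    (hX : ContDiff ℝ 1 X)
    (hS : ∀ T > 0, ∃ N : ℝ, ∀ t ∈ Set.Icc (-T) T,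
      ∀ p : EuclideanSpace ℝ (Fin n), ‖selfAdjointPart' (F (t, p))‖ ≤ N)
    (hXgrowth : ∀ T > 0, ∃ A > 0, ∃ C > 0, ∀ t ∈ Set.Icc (-T) T,
      ∀ p : EuclideanSpace ℝ (Fin n), ‖X (t, p)‖ ≤ A * ‖p‖ + C) :
    ∀ p v : EuclideanSpace ℝ (Fin n),
      ∃ γ : ℝ → EuclideanSpace ℝ (Fin n), ContDiff ℝ 2 γ ∧
        γ 0 = p ∧ deriv γ 0 = v ∧
        ∀ t : ℝ, deriv (deriv γ) t = F (t, γ t) (deriv γ t) + X (t, γ t) := by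

  intro p v
  let Y : ℝ × (EuclideanSpace ℝ (Fin n) × EuclideanSpace ℝ (Fin n)) →
      EuclideanSpace ℝ (Fin n) × EuclideanSpace ℝ (Fin n) :=
    fun q => (q.2.2, F (q.1, q.2.1) q.2.2 + X (q.1, q.2.1))
  have hY : ContDiff ℝ 1 Y := by
    have h1 : ContDiff ℝ 1
        (fun q : ℝ × (EuclideanSpace ℝ (Fin n) × EuclideanSpace ℝ (Fin n)) => (q.1, q.2.1)) := by
      fun_prop
    have h2 : ContDiff ℝ 1
        (fun q : ℝ × (EuclideanSpace ℝ (Fin n) × EuclideanSpace ℝ (Fin n)) => q.2.2) := by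
      fun_prop
    exact h2.prodMk (((hF.comp h1).clm_apply h2).add (hX.comp h1))
  obtain ⟨α, hα0, hα⟩ := aux_global Y hY (p, v) (by
    intro T hT
    obtain ⟨N, hN⟩ := hS T hT
    obtain ⟨A, hA, C, hC, hXb⟩ := hXgrowth T hT
    have hN0 : 0 ≤ N := (norm_nonneg _).trans (hN 0 ⟨by linarith, hT.le⟩ 0)
    set K := 1 + 2 * N + A + C with hK
    have hKpos : 0 ≤ K := by positivity
    set M := (‖p‖ ^ 2 + ‖v‖ ^ 2 + 1) * Real.exp (K * T) with hM
    have hMpos : 0 < M := by positivity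
    refine ⟨M + 1, by positivity, ?_⟩
    intro φ hφ α hα0 hα t ht
    let g : ℝ → ℝ := fun t => ‖(α t).1‖ ^ 2 + ‖(α t).2‖ ^ 2 + 1
    let g' : ℝ → ℝ := fun t => 2 * inner ℝ (α t).1 (φ (α t) • (α t).2) +
      2 * inner ℝ (α t).2 (φ (α t) • (F (t, (α t).1) (α t).2 + X (t, (α t).1)))
    have hg : ∀ t ∈ Set.Icc (-T) T, HasDerivWithinAt g (g' t) (Set.Icc (-T) T) t := by
      intro t ht
      have h := hα t ht
      have h1 : HasDerivWithinAt (fun s => (α s).1) (φ (α t) • (α t).2) (Set.Icc (-T) T) t :=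
        (ContinuousLinearMap.fst ℝ (EuclideanSpace ℝ (Fin n))
          (EuclideanSpace ℝ (Fin n))).hasFDerivAt.comp_hasDerivWithinAt t h
      have h2 : HasDerivWithinAt (fun s => (α s).2)
          (φ (α t) • (F (t, (α t).1) (α t).2 + X (t, (α t).1))) (Set.Icc (-T) T) t :=
        (ContinuousLinearMap.snd ℝ (EuclideanSpace ℝ (Fin n))
          (EuclideanSpace ℝ (Fin n))).hasFDerivAt.comp_hasDerivWithinAt t h
      exact (h1.norm_sq.add h2.norm_sq).add_const 1
    have hb : ∀ t ∈ Set.Icc (-T) T, |g' t| ≤ K * g t := by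
      intro t ht
      obtain ⟨hφ0, hφ1⟩ := hφ (α t)
      simp only [g', g]
      generalize (α t).1 = x at *
      generalize (α t).2 = w at *
      have e1 := abs_real_inner_le_norm x w
      have e2 := (aux_inner (F (t, x)) w).trans
        (mul_le_mul_of_nonneg_right (hN t ht x) (by positivity))
      have e3 := (abs_real_inner_le_norm w (X (t, x))).trans
        (mul_le_mul_of_nonneg_left (hXb t ht x) (norm_nonneg _))
      rw [inner_smul_right, inner_smul_right, inner_add_right]
      have : 2 * (φ (α t) * inner ℝ x w) +
          2 * (φ (α t) * (inner ℝ w (F (t, x) w) + inner ℝ w (X (t, x)))) =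
          φ (α t) * (2 * (inner ℝ x w + inner ℝ w (F (t, x) w) + inner ℝ w (X (t, x)))) := by
        ring
      rw [this, abs_mul, abs_of_nonneg hφ0]
      refine (mul_le_of_le_one_left (abs_nonneg _) hφ1).trans ?_
      rw [abs_mul, abs_two]
      have e4 := abs_add_three (inner ℝ x w) (inner ℝ w (F (t, x) w)) (inner ℝ w (X (t, x)))
      have e5 : 2 * (‖x‖ * ‖w‖) ≤ ‖x‖ ^ 2 + ‖w‖ ^ 2 := by nlinarith [sq_nonneg (‖x‖ - ‖w‖)]
      have e6 : A * (2 * (‖x‖ * ‖w‖)) ≤ A * (‖x‖ ^ 2 + ‖w‖ ^ 2) := by gcongr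
      have e7 : C * (2 * ‖w‖) ≤ C * (‖w‖ ^ 2 + 1) := by
        gcongr; nlinarith [sq_nonneg (‖w‖ - 1)]
      have e8 : 0 ≤ N * ‖x‖ ^ 2 := by positivity
      have e9 : 0 ≤ C * ‖x‖ ^ 2 := by positivity
      rw [hK]
      linarith
    have hfin := aux_gronwall hKpos hT (fun t => by positivity) hg hb t ht
    have hg0 : g 0 = ‖p‖ ^ 2 + ‖v‖ ^ 2 + 1 := by simp [g, hα0]
    rw [hg0, ← hM] at hfin
    simp only [g] at hfin
    rw [Prod.norm_def]
    apply max_le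
    · nlinarith [sq_nonneg (‖(α t).1‖ - 1), sq_nonneg ‖(α t).2‖]
    · nlinarith [sq_nonneg (‖(α t).2‖ - 1), sq_nonneg ‖(α t).1‖])
  have h1 : ∀ t, HasDerivAt (fun s => (α s).1) (α t).2 t := fun t =>
    (ContinuousLinearMap.fst ℝ (EuclideanSpace ℝ (Fin n))
          (EuclideanSpace ℝ (Fin n))).hasFDerivAt.comp_hasDerivAt t (hα t)
  have h2 : ∀ t, HasDerivAt (fun s => (α s).2) (F (t, (α t).1) (α t).2 + X (t, (α t).1)) t :=
    fun t => (ContinuousLinearMap.snd ℝ (EuclideanSpace ℝ (Fin n))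
          (EuclideanSpace ℝ (Fin n))).hasFDerivAt.comp_hasDerivAt t (hα t)
  have hd1 : deriv (fun s => (α s).1) = fun s => (α s).2 := funext fun t => (h1 t).deriv
  have hd2 : deriv (fun s => (α s).2) = fun t => F (t, (α t).1) (α t).2 + X (t, (α t).1) :=
    funext fun t => (h2 t).deriv
  have hc1 : Continuous fun s => (α s).1 :=
    continuous_iff_continuousAt.2 fun t => (h1 t).continuousAt
  have hc2 : Continuous fun s => (α s).2 :=
    continuous_iff_continuousAt.2 fun t => (h2 t).continuousAt
  have hFc := hF.continuous
  have hXc := hX.continuous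
  refine ⟨fun s => (α s).1, ?_, by simp [hα0], by simp [hd1, hα0], fun t => ?_⟩
  · have : (2 : WithTop ℕ∞) = 1 + 1 := by norm_num
    rw [this, contDiff_succ_iff_deriv]
    refine ⟨fun t => (h1 t).differentiableAt, by simp, ?_⟩
    rw [hd1, contDiff_one_iff_deriv]
    refine ⟨fun t => (h2 t).differentiableAt, ?_⟩
    rw [hd2]
    exact ((hFc.comp (continuous_id.prodMk hc1)).clm_apply hc2).add
      (hXc.comp (continuous_id.prodMk hc1))
  · rw [hd1, hd2]
end

section
/- Let F : ℝ × ℝⁿ → (ℝⁿ →L ℝⁿ) and X : ℝ × ℝⁿ → ℝⁿ be continuously differentiable and ℤⁿ-periodic in the space variable, i.e. F(t, p + k) = F(t, p) and X(t, p + k) = X(t, p) for all t ∈ ℝ, p ∈ ℝⁿ and k ∈ ℤⁿ. Then for every (p, v) ∈ ℝⁿ × ℝⁿ there exists a twice continuously differentiable curve γ : ℝ → ℝⁿ with γ(0) = p, γ'(0) = v, and γ''(t) = F(t, γ(t))(γ'(t)) + X(t, γ(t)) for all t ∈ ℝ. -/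
open Set Filter Topology NNReal

lemma aux_lipOn {E : Type*} [NormedAddCommGroup E] [ProperSpace E]
    {G : ℝ × E → E} (hG : LocallyLipschitz G) (T : ℝ) (x₀ : E) (R : ℝ) :
    ∃ K : ℝ≥0, ∀ t ∈ Icc (-T) T,
      LipschitzOnWith K (fun x => G (t, x)) (Metric.closedBall x₀ R) := by
  obtain ⟨K, hK⟩ := LocallyLipschitzOn.exists_lipschitzOnWith_of_compact
    (s := Icc (-T) T ×ˢ Metric.closedBall x₀ R)
    (isCompact_Icc.prod (isCompact_closedBall x₀ R)) hG.locallyLipschitzOn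
  refine ⟨K, fun t ht => ?_⟩
  have := hK.comp ((LipschitzWith.prodMk_left t).lipschitzOnWith
    (s := Metric.closedBall x₀ R)) (fun x hx => ⟨ht, hx⟩)
  rwa [mul_one] at this

lemma aux_exists_bdd {E : Type*} [NormedAddCommGroup E] [NormedSpace ℝ E] [ProperSpace E]
    {G : ℝ × E → E} (hG : LocallyLipschitz G) {T : ℝ} (hT : 0 < T) (L : ℝ≥0)
    (hL : ∀ t ∈ Icc (-T) T, ∀ x, ‖G (t, x)‖ ≤ L) (x₀ : E) :
    ∃ α : ℝ → E, α 0 = x₀ ∧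
      ∀ t ∈ Icc (-T) T, HasDerivWithinAt α (G (t, α t)) (Icc (-T) T) t := by
  obtain ⟨K, hK⟩ := aux_lipOn hG T x₀ (L * T)
  have h0 : (0 : ℝ) ∈ Icc (-T) T := ⟨by linarith, hT.le⟩
  have hPL : IsPicardLindelof (fun t x => G (t, x)) (⟨0, h0⟩ : Icc (-T) T) x₀
      (L * T.toNNReal) 0 L K := by
    have hc : ((L * T.toNNReal : ℝ≥0) : ℝ) = L * T := by
      push_cast
      rw [Real.coe_toNNReal _ hT.le]
    refine ⟨?_, ?_, ?_, ?_⟩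
    · rw [hc]; exact hK
    · intro x _
      exact (hG.continuous.comp (by fun_prop : Continuous fun t : ℝ => (t, x))).continuousOn
    · intro t ht x _
      exact hL t ht x
    · rw [hc]; simp
  exact hPL.exists_eq_forall_mem_Icc_hasDerivWithinAt₀

lemma aux_hasDerivAt {E : Type*} [NormedAddCommGroup E] [NormedSpace ℝ E]
    {α : ℝ → E} {a : E} {T t : ℝ} (h : HasDerivWithinAt α a (Icc (-T) T) t)
    (ht : t ∈ Ioo (-T) T) : HasDerivAt α a t :=
  h.hasDerivAt (Icc_mem_nhds ht.1 ht.2)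

/-- Gluing solutions on an exhausting family of intervals. -/
lemma aux_global_s8 {E : Type*} [NormedAddCommGroup E] [NormedSpace ℝ E] [ProperSpace E]
    {G : ℝ × E → E} (hG : LocallyLipschitz G) (x₀ : E)
    (H : ∀ T : ℝ, 0 < T → ∃ α : ℝ → E, α 0 = x₀ ∧
      ∀ t ∈ Icc (-T) T, HasDerivWithinAt α (G (t, α t)) (Icc (-T) T) t) :
    ∃ α : ℝ → E, α 0 = x₀ ∧ ∀ t, HasDerivAt α (G (t, α t)) t := by
  choose! A hA0 hA using H
  have key : ∀ S T, 0 < S → S ≤ T → EqOn (A S) (A T) (Ioo (-S) S) := by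
    intro S T hS hST
    have hT : 0 < T := hS.trans_le hST
    have cS : ContinuousOn (A S) (Icc (-S) S) := fun t ht => (hA S hS t ht).continuousWithinAt
    have cT : ContinuousOn (A T) (Icc (-S) S) :=
      ContinuousOn.mono (fun t ht => (hA T hT t ht).continuousWithinAt)
        (Icc_subset_Icc (neg_le_neg hST) hST)
    obtain ⟨R₁, h₁⟩ := (isCompact_Icc.image_of_continuousOn cS).isBounded.subset_closedBall (0 : E)
    obtain ⟨R₂, h₂⟩ := (isCompact_Icc.image_of_continuousOn cT).isBounded.subset_closedBall (0 : E)
    obtain ⟨K, hK⟩ := aux_lipOn hG S (0 : E) (max R₁ R₂)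
    refine ODE_solution_unique_of_mem_Ioo (v := fun t x => G (t, x)) (K := K)
      (s := fun _ => Metric.closedBall (0 : E) (max R₁ R₂)) (t₀ := 0)
      (fun t ht => hK t (Ioo_subset_Icc_self ht)) ⟨by linarith, hS⟩ ?_ ?_ ?_
    · intro t ht
      exact ⟨aux_hasDerivAt (hA S hS t (Ioo_subset_Icc_self ht)) ht,
        Metric.closedBall_subset_closedBall (le_max_left _ _)
          (h₁ (mem_image_of_mem _ (Ioo_subset_Icc_self ht)))⟩
    · intro t ht
      have ht' : t ∈ Ioo (-T) T := ⟨by linarith [ht.1], by linarith [ht.2]⟩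
      exact ⟨aux_hasDerivAt (hA T hT t (Ioo_subset_Icc_self ht')) ht',
        Metric.closedBall_subset_closedBall (le_max_right _ _)
          (h₂ (mem_image_of_mem _ (Ioo_subset_Icc_self ht)))⟩
    · rw [hA0 S hS, hA0 T hT]
  have hev : ∀ t, (fun s => A (|s| + 1) s) =ᶠ[𝓝 t] A (|t| + 2) := by
    intro t
    have : ∀ᶠ s in 𝓝 t, |s| < |t| + 1 :=
      continuous_abs.continuousAt.eventually_lt continuousAt_const (by simp)
    filter_upwards [this] with s hs
    refine key (|s| + 1) (|t| + 2) (by positivity) (by linarith) ?_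
    rw [mem_Ioo, ← abs_lt]; linarith
  refine ⟨fun s => A (|s| + 1) s, ?_, fun t => ?_⟩
  · exact hA0 _ (by positivity)
  · have ht : t ∈ Ioo (-(|t| + 2)) (|t| + 2) := by rw [mem_Ioo, ← abs_lt]; linarith
    have h := aux_hasDerivAt (hA (|t| + 2) (by positivity) t (Ioo_subset_Icc_self ht)) ht
    have h2 := h.congr_of_eventuallyEq (hev t)
    have h3 := (hev t).eq_of_nhds
    simp only at h3 ⊢
    rwa [h3]

lemma aux_gronwall_right {E : Type*} [NormedAddCommGroup E] [NormedSpace ℝ E]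
    {α α' : ℝ → E} {T C : ℝ}
    (h : ∀ t ∈ Icc (-T) T, HasDerivWithinAt α (α' t) (Icc (-T) T) t)
    (hb : ∀ t ∈ Icc (-T) T, ‖α' t‖ ≤ C * ‖α t‖ + C) (hC : 0 ≤ C) :
    ∀ t ∈ Icc 0 T, ‖α t‖ ≤ gronwallBound ‖α 0‖ C C T := by
  intro t ht
  have hT : 0 ≤ T := ht.1.trans ht.2
  have hsub : Icc 0 T ⊆ Icc (-T) T := Icc_subset_Icc (by linarith) le_rfl
  have := norm_le_gronwallBound_of_norm_deriv_right_le (f := α) (f' := α') (δ := ‖α 0‖) (K := C)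
    (ε := C) (a := 0) (b := T)
    (fun s hs => ((h s (hsub hs)).continuousWithinAt).mono hsub)
    (fun s hs => (h s (hsub (Ico_subset_Icc_self hs))).mono_of_mem_nhdsWithin
      (mem_of_superset (Icc_mem_nhdsGE hs.2) (Icc_subset_Icc (by linarith [hs.1]) le_rfl))) le_rfl
    (fun s hs => hb s (hsub (Ico_subset_Icc_self hs))) t ht
  exact this.trans (gronwallBound_mono (norm_nonneg _) hC hC (by linarith [ht.2]))

lemma aux_gronwall_s8 {E : Type*} [NormedAddCommGroup E] [NormedSpace ℝ E]
    {α α' : ℝ → E} {T C : ℝ}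
    (h : ∀ t ∈ Icc (-T) T, HasDerivWithinAt α (α' t) (Icc (-T) T) t)
    (hb : ∀ t ∈ Icc (-T) T, ‖α' t‖ ≤ C * ‖α t‖ + C) (hC : 0 ≤ C) :
    ∀ t ∈ Icc (-T) T, ‖α t‖ ≤ gronwallBound ‖α 0‖ C C T := by
  intro t ht
  rcases le_total 0 t with h0 | h0
  · exact aux_gronwall_right h hb hC t ⟨h0, ht.2⟩
  · have hm : ∀ s ∈ Icc (-T) T, -s ∈ Icc (-T) T :=
      fun s hs => ⟨by linarith [hs.2], by linarith [hs.1]⟩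
    have := aux_gronwall_right (α := fun s => α (-s)) (α' := fun s => -α' (-s)) (T := T) (C := C)
      (fun s hs => by
        have := HasDerivWithinAt.scomp s (h (-s) (hm s hs))
          (hasDerivAt_neg s).hasDerivWithinAt hm
        simpa [Function.comp_def] using this)
      (fun s hs => by simpa using hb (-s) (hm s hs)) hC (-t) ⟨by linarith, by linarith [ht.1]⟩
    simpa using this

/-- Coordinatewise truncation. -/
noncomputable def auxClamp {n : ℕ} (R : ℝ) (y : Fin n → ℝ) : Fin n → ℝ :=
  fun i => max (-R) (min R (y i))

lemma auxClamp_lip {n : ℕ} (R : ℝ) : LipschitzWith 1 (auxClamp R : (Fin n → ℝ) → _) := by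
  refine LipschitzWith.of_dist_le_mul fun x y => ?_
  rw [NNReal.coe_one, one_mul, dist_pi_le_iff dist_nonneg]
  intro i
  have h : LipschitzWith 1 (fun z : ℝ => max (-R) (min R z)) :=
    (LipschitzWith.id.const_min R).const_max (-R)
  have := h.dist_le_mul (x i) (y i)
  rw [NNReal.coe_one, one_mul] at this
  exact this.trans (dist_le_pi_dist x y i)

lemma auxClamp_norm_le {n : ℕ} {R : ℝ} (hR : 0 ≤ R) (y : Fin n → ℝ) : ‖auxClamp R y‖ ≤ R := by
  rw [pi_norm_le_iff_of_nonneg hR]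
  intro i
  rw [Real.norm_eq_abs, abs_le]
  exact ⟨le_max_left _ _, max_le (by linarith) (min_le_left _ _)⟩

lemma auxClamp_norm_le' {n : ℕ} {R : ℝ} (hR : 0 ≤ R) (y : Fin n → ℝ) :
    ‖auxClamp R y‖ ≤ ‖y‖ := by
  have h0 : auxClamp R (0 : Fin n → ℝ) = 0 := by
    ext i; simp [auxClamp, hR]
  simpa [h0] using (auxClamp_lip (n := n) R).dist_le_mul y 0

lemma auxClamp_eq {n : ℕ} {R : ℝ} {y : Fin n → ℝ} (hy : ‖y‖ ≤ R) : auxClamp R y = y := by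
  ext i
  have := (norm_le_pi_norm y i).trans hy
  rw [Real.norm_eq_abs, abs_le] at this
  simp [auxClamp, this.1, this.2]

lemma aux_periodic_bdd {n : ℕ} {V : Type*} [NormedAddCommGroup V]
    {F : ℝ × (Fin n → ℝ) → V} (hF : Continuous F)
    (hper : ∀ (t : ℝ) (p : Fin n → ℝ) (k : Fin n → ℤ),
      F (t, p + fun i => (k i : ℝ)) = F (t, p)) (T : ℝ) :
    ∃ C : ℝ, ∀ t ∈ Icc (-T) T, ∀ x, ‖F (t, x)‖ ≤ C := by
  obtain ⟨C, hC⟩ := ((isCompact_Icc (a := -T) (b := T)).prod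
    (isCompact_Icc (a := (0 : Fin n → ℝ)) (b := 1))).exists_bound_of_continuousOn hF.continuousOn
  refine ⟨C, fun t ht x => ?_⟩
  have hx : x = (fun i => Int.fract (x i)) + fun i => ((⌊x i⌋ : ℤ) : ℝ) := by
    ext i; simp
  rw [hx, hper]
  exact hC _ ⟨ht, fun i => Int.fract_nonneg _, fun i => (Int.fract_lt_one _).le⟩


/-- The last assertion of Theorem 2 for the flat torus `ℝⁿ/ℤⁿ`: if `F` and `X`
are continuously differentiable and `ℤⁿ`-periodic in the space variable, then
for every initial condition the equation `γ'' = F(t,γ)(γ') + X(t,γ)` has a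
globally defined solution. -/
theorem completeness_periodic_data {n : ℕ}
    (F : ℝ × (Fin n → ℝ) → ((Fin n → ℝ) →L[ℝ] (Fin n → ℝ)))
    (hF : ContDiff ℝ 1 F)
    (X : ℝ × (Fin n → ℝ) → (Fin n → ℝ))
    (hX : ContDiff ℝ 1 X)
    (hFper : ∀ (t : ℝ) (p : Fin n → ℝ) (k : Fin n → ℤ),
      F (t, p + fun i => (k i : ℝ)) = F (t, p))
    (hXper : ∀ (t : ℝ) (p : Fin n → ℝ) (k : Fin n → ℤ),
      X (t, p + fun i => (k i : ℝ)) = X (t, p)) :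
    ∀ p v : Fin n → ℝ,
      ∃ γ : ℝ → (Fin n → ℝ), ContDiff ℝ 2 γ ∧
        γ 0 = p ∧ deriv γ 0 = v ∧
        ∀ t : ℝ, deriv (deriv γ) t = F (t, γ t) (deriv γ t) + X (t, γ t) := by
  intro p v
  set G : ℝ × ((Fin n → ℝ) × (Fin n → ℝ)) → (Fin n → ℝ) × (Fin n → ℝ) :=
    fun q => (q.2.2, F (q.1, q.2.1) q.2.2 + X (q.1, q.2.1)) with hGdef
  have hGc : ContDiff ℝ 1 G := by
    refine ContDiff.prodMk (by fun_prop) (ContDiff.add (ContDiff.clm_apply ?_ (by fun_prop)) ?_)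
    · exact hF.comp (by fun_prop)
    · exact hX.comp (by fun_prop)
  have hG : LocallyLipschitz G := hGc.locallyLipschitz
  obtain ⟨α, hα0, hα⟩ := aux_global_s8 hG (p, v) (by
    intro T hT
    obtain ⟨C₁, hC₁⟩ := aux_periodic_bdd hF.continuous hFper T
    obtain ⟨C₂, hC₂⟩ := aux_periodic_bdd hX.continuous hXper T
    obtain ⟨C, hC0, hCF, hCX⟩ : ∃ C : ℝ, 0 ≤ C ∧ (∀ t ∈ Icc (-T) T, ∀ x, ‖F (t, x)‖ ≤ C) ∧
        (∀ t ∈ Icc (-T) T, ∀ x, ‖X (t, x)‖ ≤ C) :=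
      ⟨max 0 (max C₁ C₂), le_max_left _ _,
        fun t ht x => (hC₁ t ht x).trans ((le_max_left _ _).trans (le_max_right _ _)),
        fun t ht x => (hC₂ t ht x).trans ((le_max_right _ _).trans (le_max_right _ _))⟩
    set R := gronwallBound ‖v‖ C C T with hR
    have hR0 : 0 ≤ R := by
      have := gronwallBound_mono (norm_nonneg v) hC0 hC0 hT.le
      rw [gronwallBound_x0] at this
      exact (norm_nonneg v).trans this
    have hbd : ∀ t ∈ Icc (-T) T, ∀ x y : Fin n → ℝ,
        ‖F (t, x) y + X (t, x)‖ ≤ C * ‖y‖ + C := by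
      intro t ht x y
      refine (norm_add_le _ _).trans (add_le_add ?_ (hCX t ht x))
      exact ((F (t, x)).le_opNorm y).trans
        (mul_le_mul_of_nonneg_right (hCF t ht x) (norm_nonneg y))
    have hρ : LocallyLipschitz (fun q : ℝ × ((Fin n → ℝ) × (Fin n → ℝ)) =>
        (q.1, (q.2.1, auxClamp R q.2.2))) := by
      have h2 : LipschitzWith 1 (fun q : ℝ × ((Fin n → ℝ) × (Fin n → ℝ)) => q.2.1) :=
        (LipschitzWith.prod_fst.comp LipschitzWith.prod_snd).weaken (by simp)
      have h3 : LipschitzWith (1 * (1 * 1))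
          (fun q : ℝ × ((Fin n → ℝ) × (Fin n → ℝ)) => auxClamp R q.2.2) :=
        (auxClamp_lip R).comp (LipschitzWith.prod_snd.comp LipschitzWith.prod_snd)
      exact (LipschitzWith.prod_fst.prodMk (h2.prodMk h3)).locallyLipschitz
    obtain ⟨α, hα0, hα⟩ := aux_exists_bdd (hG.comp hρ) hT (max R (C * R + C)).toNNReal (by
      intro t ht x
      have hn := auxClamp_norm_le hR0 x.2
      refine le_trans ?_ (Real.le_coe_toNNReal _)
      refine max_le_max hn ((hbd t ht x.1 (auxClamp R x.2)).trans ?_)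
      gcongr) (p, v)
    refine ⟨α, hα0, fun t ht => ?_⟩
    have hy : ∀ t ∈ Icc (-T) T, ‖(α t).2‖ ≤ R := by
      have := aux_gronwall_s8 (α := fun t => (α t).2)
        (α' := fun t => F (t, (α t).1) (auxClamp R (α t).2) + X (t, (α t).1)) (T := T) (C := C)
        (fun t ht => (hα t ht).snd) (fun t ht => (hbd t ht _ _).trans (by
          gcongr
          exact auxClamp_norm_le' hR0 _)) hC0
      simpa [hα0] using this
    have := hα t ht
    simp only [Function.comp_apply, auxClamp_eq (hy t ht)] at this
    exact this)
  have hd1 : ∀ t, HasDerivAt (fun t => (α t).1) (α t).2 t := fun t => (hα t).fst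
  have hd2 : ∀ t, HasDerivAt (fun t => (α t).2)
      (F (t, (α t).1) (α t).2 + X (t, (α t).1)) t := fun t => (hα t).snd
  have e1 : deriv (fun t => (α t).1) = fun t => (α t).2 := funext fun t => (hd1 t).deriv
  have e2 : deriv (fun t => (α t).2) = fun t => F (t, (α t).1) (α t).2 + X (t, (α t).1) :=
    funext fun t => (hd2 t).deriv
  have hαc : Continuous α := continuous_iff_continuousAt.2 fun t => (hα t).continuousAt
  refine ⟨fun t => (α t).1, ?_, by simp [hα0], by rw [e1]; simp [hα0], fun t => ?_⟩
  · rw [show (2 : WithTop ℕ∞) = 1 + 1 by norm_num, contDiff_succ_iff_deriv]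
    refine ⟨fun t => (hd1 t).differentiableAt, by simp, ?_⟩
    rw [e1, contDiff_one_iff_deriv]
    refine ⟨fun t => (hd2 t).differentiableAt, ?_⟩
    rw [e2]
    exact (hGc.continuous.comp (continuous_id.prodMk hαc)).snd
  · rw [e1, e2]
end

section
/- Let F : ℝ × ℝⁿ → (ℝⁿ →L ℝⁿ) be continuously differentiable with self-adjoint part S(t,p) = (F(t,p) + F(t,p)*)/2 with respect to the Euclidean inner product, and let V : ℝⁿ × ℝ → ℝ be twice continuously differentiable, with ∇ᴹV(p, t) denoting the Euclidean gradient of p ↦ V(p, t). Assume, for each T > 0, the existence of constants N_T, A_T, C_T > 0 such that for all t ∈ [−T, T] and all p ∈ ℝⁿ: (i) ‖S(t,p)‖ ≤ N_T; (ii) −V(p, t) ≤ A_T ‖p‖² + C_T; (iii) |∂V/∂t (p, t)| ≤ A_T ‖p‖² + C_T. Then for every (p, v) ∈ ℝⁿ × ℝⁿ there exists a twice continuously differentiable curve γ : ℝ → ℝⁿ with γ(0) = p, γ'(0) = v, and γ''(t) = F(t, γ(t))(γ'(t)) − ∇ᴹV(γ(t), t) for all t ∈ ℝ. -/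
open Set Metric Filter Topology in
lemma cqp_lip {E : Type*} [NormedAddCommGroup E] [NormedSpace ℝ E] [FiniteDimensional ℝ E]
    (f : ℝ → E → E) (hf : ContDiff ℝ 1 (Function.uncurry f)) (T : ℝ) (x : E) (R : ℝ) :
    ∃ K : NNReal, ∀ t ∈ Icc (-T) T, LipschitzOnWith K (f t) (closedBall x R) := by
  have hc : IsCompact (Icc (-T) T ×ˢ closedBall x R) :=
    isCompact_Icc.prod (isCompact_closedBall x R)
  have hd : Continuous (fderiv ℝ (Function.uncurry f)) := hf.continuous_fderiv one_ne_zero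
  obtain ⟨C, hC⟩ := hc.exists_bound_of_continuousOn hd.continuousOn
  refine ⟨C.toNNReal, fun t ht => ?_⟩
  have hconv : Convex ℝ (Icc (-T) T ×ˢ closedBall x R) :=
    (convex_Icc _ _).prod (convex_closedBall x R)
  have hl : LipschitzOnWith C.toNNReal (Function.uncurry f) (Icc (-T) T ×ˢ closedBall x R) := by
    refine hconv.lipschitzOnWith_of_nnnorm_fderiv_le
      (fun y _ => (hf.differentiable one_ne_zero) y) (fun y hy => ?_)
    rw [← NNReal.coe_le_coe, coe_nnnorm]
    exact (hC y hy).trans (Real.le_coe_toNNReal C)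
  have h2 := hl.comp (g := Function.uncurry f) (f := fun y : E => (t, y)) (s := closedBall x R)
    (LipschitzWith.prodMk_left t).lipschitzOnWith (fun y hy => ⟨ht, hy⟩)
  rw [mul_one] at h2
  exact h2

open Set Metric Filter Topology in
lemma cqp_local {E : Type*} [NormedAddCommGroup E] [NormedSpace ℝ E] [FiniteDimensional ℝ E]
    (f : ℝ → E → E) (hf : ContDiff ℝ 1 (Function.uncurry f)) (x₀ : E) (T : ℝ) (hT : 0 < T)
    (R : ℝ)
    (hR : ∀ (z : ℝ → E) (c : ℝ → ℝ), (∀ t, 0 ≤ c t ∧ c t ≤ 1) → z 0 = x₀ →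
      (∀ t ∈ Icc (-T) T, HasDerivAt z (c t • f t (z t)) t) → ∀ t ∈ Icc (-T) T, ‖z t‖ ≤ R) :
    ∃ z : ℝ → E, z 0 = x₀ ∧ ∀ t ∈ Icc (-T) T, HasDerivAt z (f t (z t)) t := by
  have : CompleteSpace E := FiniteDimensional.complete ℝ E
  let χ : ContDiffBump (0 : E) :=
    ⟨|R| + 1, |R| + 2, by positivity, by linarith⟩
  let g : ℝ → E → E := fun t x => χ x • f t x
  have hg : ContDiff ℝ 1 (Function.uncurry g) := by
    have h1 : ContDiff ℝ 1 (fun q : ℝ × E => χ q.2) := χ.contDiff.comp contDiff_snd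
    exact h1.smul hf
  have hc : IsCompact (Icc (-(T+1)) (T+1) ×ˢ closedBall (0:E) (|R|+2)) :=
    isCompact_Icc.prod (isCompact_closedBall _ _)
  obtain ⟨C, hC⟩ := hc.exists_bound_of_continuousOn hg.continuous.continuousOn
  have hCb : ∀ t ∈ Icc (-(T+1)) (T+1), ∀ x, ‖g t x‖ ≤ C.toNNReal := by
    intro t ht x
    by_cases hx : x ∈ closedBall (0:E) (|R|+2)
    · exact (hC (t, x) ⟨ht, hx⟩).trans (Real.le_coe_toNNReal C)
    · have : χ x = 0 := χ.zero_of_le_dist (by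
        rw [mem_closedBall, not_le] at hx; exact hx.le)
      simp [g, this]
  obtain ⟨K, hK⟩ := cqp_lip g hg (T+1) x₀ (C.toNNReal * (T+1))
  have h0 : (0:ℝ) ∈ Icc (-(T+1)) (T+1) := ⟨by linarith, by linarith⟩
  have hpl : IsPicardLindelof g (tmin := -(T+1)) (tmax := T+1) ⟨0, h0⟩ x₀
      (C.toNNReal * (T+1).toNNReal) 0 C.toNNReal K := by
    have e : ((T+1).toNNReal : ℝ) = T + 1 := Real.coe_toNNReal _ (by linarith)
    refine ⟨?_, ?_, ?_, ?_⟩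
    · intro t ht
      have := hK t ht
      simpa [e] using this
    · intro x _
      have : Continuous (fun t => Function.uncurry g (t, x)) := hg.continuous.comp (by fun_prop)
      exact this.continuousOn
    · intro t ht x _
      exact hCb t ht x
    · simp [e]
  obtain ⟨z, hz0, hz⟩ := hpl.exists_eq_forall_mem_Icc_hasDerivWithinAt₀
  have hz' : ∀ t ∈ Icc (-T) T, HasDerivAt z (χ (z t) • f t (z t)) t := by
    intro t ht
    exact (hz t ⟨by linarith [ht.1], by linarith [ht.2]⟩).hasDerivAt
      (Icc_mem_nhds (by linarith [ht.1]) (by linarith [ht.2]))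
  have hb := hR z (fun t => χ (z t)) (fun t => ⟨χ.nonneg, χ.le_one⟩) hz0 hz'
  refine ⟨z, hz0, fun t ht => ?_⟩
  have h1 : χ (z t) = 1 := χ.one_of_mem_closedBall (by
    rw [mem_closedBall, dist_zero_right]
    have := hb t ht
    have := le_abs_self R
    change ‖z t‖ ≤ |R| + 1
    linarith)
  simpa [h1] using hz' t ht

open Set Metric Filter Topology in
lemma cqp_unique {E : Type*} [NormedAddCommGroup E] [NormedSpace ℝ E] [FiniteDimensional ℝ E]
    (f : ℝ → E → E) (hf : ContDiff ℝ 1 (Function.uncurry f)) (T : ℝ) (hT : 0 < T)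
    (z w : ℝ → E) (h0 : z 0 = w 0)
    (hz : ∀ t ∈ Icc (-T) T, HasDerivAt z (f t (z t)) t)
    (hw : ∀ t ∈ Icc (-T) T, HasDerivAt w (f t (w t)) t) : EqOn z w (Icc (-T) T) := by
  have cz : ContinuousOn z (Icc (-T) T) := fun t ht => (hz t ht).continuousAt.continuousWithinAt
  have cw : ContinuousOn w (Icc (-T) T) := fun t ht => (hw t ht).continuousAt.continuousWithinAt
  obtain ⟨B, hB⟩ := isCompact_Icc.exists_bound_of_continuousOn cz
  obtain ⟨B', hB'⟩ := isCompact_Icc.exists_bound_of_continuousOn cw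
  obtain ⟨K, hK⟩ := cqp_lip f hf T 0 (max B B')
  have hss := @Ioo_subset_Icc_self ℝ _ (-T) T
  refine ODE_solution_unique_of_mem_Icc (v := f) (s := fun _ => closedBall 0 (max B B'))
    (t₀ := 0) (K := K) (fun t ht => hK t (hss ht)) ⟨by linarith, hT⟩ cz (fun t ht => hz t (hss ht))
    (fun t ht => ?_) cw (fun t ht => hw t (hss ht)) (fun t ht => ?_) h0
  · simpa using Or.inl (hB t (hss ht))
  · simpa using Or.inr (hB' t (hss ht))

open Set Metric Filter Topology in
lemma cqp_global {E : Type*} [NormedAddCommGroup E] [NormedSpace ℝ E] [FiniteDimensional ℝ E]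
    (f : ℝ → E → E) (hf : ContDiff ℝ 1 (Function.uncurry f)) (x₀ : E)
    (hR : ∀ T > 0, ∃ R : ℝ, ∀ (z : ℝ → E) (c : ℝ → ℝ), (∀ t, 0 ≤ c t ∧ c t ≤ 1) → z 0 = x₀ →
      (∀ t ∈ Icc (-T) T, HasDerivAt z (c t • f t (z t)) t) → ∀ t ∈ Icc (-T) T, ‖z t‖ ≤ R) :
    ∃ z : ℝ → E, z 0 = x₀ ∧ ∀ t, HasDerivAt z (f t (z t)) t := by
  have H : ∀ T : ℝ, 0 < T → ∃ z : ℝ → E, z 0 = x₀ ∧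
      ∀ t ∈ Icc (-T) T, HasDerivAt z (f t (z t)) t := by
    intro T hT
    obtain ⟨R, h⟩ := hR T hT
    exact cqp_local f hf x₀ T hT R h
  choose! Z hZ0 hZ using H
  have key : ∀ S T : ℝ, 0 < S → S ≤ T → EqOn (Z S) (Z T) (Icc (-S) S) := by
    intro S T hS hST
    refine cqp_unique f hf S hS _ _ ?_ (hZ S hS) (fun t ht => hZ T (by linarith) t ?_)
    · rw [hZ0 S hS, hZ0 T (by linarith)]
    · exact ⟨by linarith [ht.1], by linarith [ht.2]⟩
  refine ⟨fun t => Z (|t| + 1) t, hZ0 _ (by positivity), fun t => ?_⟩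
  have hd := hZ (|t| + 2) (by positivity) t
    ⟨by linarith [neg_abs_le t], by linarith [le_abs_self t]⟩
  have hev : ∀ s : ℝ, |s| < |t| + 1 → Z (|s| + 1) s = Z (|t| + 2) s := by
    intro s hs
    exact key (|s| + 1) (|t| + 2) (by positivity) (by linarith)
      ⟨by linarith [neg_abs_le s], by linarith [le_abs_self s]⟩
  have e := hev t (by linarith)
  simp only [e]
  refine hd.congr_of_eventuallyEq ?_
  have : ∀ᶠ s in 𝓝 t, |s| < |t| + 1 :=
    continuous_abs.continuousAt.eventually_lt continuousAt_const (by linarith)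
  filter_upwards [this] with s hs using hev s hs

open Set in
lemma cqp_gronwall (W W' : ℝ → ℝ) (K T : ℝ) (hK : 0 ≤ K)
    (hd : ∀ t ∈ Icc (-T) T, HasDerivAt W (W' t) t)
    (hb : ∀ t ∈ Icc (-T) T, |W' t| ≤ K * W t) (hW : ∀ t ∈ Icc (-T) T, 0 ≤ W t) :
    ∀ t ∈ Icc (-T) T, W t ≤ W 0 * Real.exp (K * T) := by
  have main : ∀ σ : ℝ, |σ| = 1 → ∀ s ∈ Icc 0 T, W (σ * s) ≤ W 0 * Real.exp (K * T) := by
    intro σ hσ s hs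
    have hm : ∀ r ∈ Icc 0 T, σ * r ∈ Icc (-T) T := by
      intro r hr
      have : |σ * r| ≤ T := by rw [abs_mul, hσ, one_mul, abs_of_nonneg hr.1]; exact hr.2
      exact abs_le.mp this
    have hder : ∀ r ∈ Icc 0 T, HasDerivAt (fun u => W (σ * u)) (W' (σ * r) * σ) r := by
      intro r hr
      have h1 : HasDerivAt (fun u : ℝ => σ * u) σ r := by
        simpa using (hasDerivAt_id r).const_mul σ
      exact (hd _ (hm r hr)).comp r h1
    have hT0 : 0 ≤ T := hs.1.trans hs.2
    have h0 : 0 ≤ W 0 := hW 0 ⟨by linarith, hT0⟩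
    have := norm_le_gronwallBound_of_norm_deriv_right_le (f := fun u => W (σ * u))
      (f' := fun r => W' (σ * r) * σ) (δ := W 0) (K := K) (ε := 0) (a := 0) (b := T)
      (fun r hr => (hder r hr).continuousAt.continuousWithinAt)
      (fun r hr => (hder r (Ico_subset_Icc_self hr)).hasDerivWithinAt)
      (by simp [abs_of_nonneg h0])
      (fun r hr => by
        have hr' := hm r (Ico_subset_Icc_self hr)
        rw [Real.norm_eq_abs, Real.norm_eq_abs, abs_mul, hσ, abs_of_nonneg (hW _ hr')]
        linarith [hb _ hr']) s hs
    rw [gronwallBound_ε0, sub_zero] at this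
    refine (le_abs_self _).trans (this.trans ?_)
    have := hs.2
    gcongr
  intro t ht
  rcases le_total 0 t with h | h
  · simpa using main 1 (by simp) t ⟨h, ht.2⟩
  · simpa using main (-1) (by simp) (-t) ⟨by linarith, by linarith [ht.1]⟩

lemma cqp_selfAdj {n : ℕ} (A : EuclideanSpace ℝ (Fin n) →L[ℝ] EuclideanSpace ℝ (Fin n))
    (N : ℝ) (h : ‖selfAdjointPart' A‖ ≤ N) (y : EuclideanSpace ℝ (Fin n)) :
    |inner ℝ y (A y)| ≤ N * ‖y‖ ^ 2 := by
  have e : inner ℝ y (A y) = inner ℝ y (selfAdjointPart' A y) := by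
    simp only [selfAdjointPart', smul_apply, add_apply,
      inner_smul_right, inner_add_right, ContinuousLinearMap.adjoint_inner_right]
    rw [real_inner_comm y (A y)]
    ring
  rw [e]
  calc |inner ℝ y (selfAdjointPart' A y)| ≤ ‖y‖ * ‖selfAdjointPart' A y‖ :=
        abs_real_inner_le_norm _ _
    _ ≤ ‖y‖ * (‖selfAdjointPart' A‖ * ‖y‖) := by
        gcongr; exact ContinuousLinearMap.le_opNorm _ _
    _ ≤ ‖y‖ * (N * ‖y‖) := by gcongr
    _ = N * ‖y‖ ^ 2 := by ring

lemma cqp_fderiv_fst {n : ℕ} (V : EuclideanSpace ℝ (Fin n) × ℝ → ℝ) (hV : ContDiff ℝ 2 V)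
    (x : EuclideanSpace ℝ (Fin n)) (t : ℝ) :
    fderiv ℝ (fun q => V (q, t)) x =
      (fderiv ℝ V (x, t)).comp (ContinuousLinearMap.inl ℝ (EuclideanSpace ℝ (Fin n)) ℝ) := by
  have h1 : HasFDerivAt V (fderiv ℝ V (x, t)) (x, t) :=
    (hV.differentiable two_ne_zero _).hasFDerivAt
  exact (h1.comp x (hasFDerivAt_prodMk_left x t)).fderiv

lemma cqp_deriv_snd {n : ℕ} (V : EuclideanSpace ℝ (Fin n) × ℝ → ℝ) (hV : ContDiff ℝ 2 V)
    (x : EuclideanSpace ℝ (Fin n)) (t : ℝ) :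
    deriv (fun s => V (x, s)) t = fderiv ℝ V (x, t) (0, 1) := by
  have h1 : HasFDerivAt V (fderiv ℝ V (x, t)) (x, t) :=
    (hV.differentiable two_ne_zero _).hasFDerivAt
  have h2 : HasDerivAt (fun s : ℝ => (x, s)) ((0 : EuclideanSpace ℝ (Fin n)), (1 : ℝ)) t :=
    (hasDerivAt_const t x).prodMk (hasDerivAt_id t)
  exact (h1.comp_hasDerivAt t h2).deriv

lemma cqp_grad_inner {n : ℕ} (V : EuclideanSpace ℝ (Fin n) × ℝ → ℝ) (hV : ContDiff ℝ 2 V)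
    (x y : EuclideanSpace ℝ (Fin n)) (t : ℝ) :
    inner ℝ (gradient (fun q => V (q, t)) x) y = fderiv ℝ V (x, t) (y, 0) := by
  rw [gradient, InnerProductSpace.toDual_symm_apply, cqp_fderiv_fst V hV]
  simp

lemma cqp_field_contDiff {n : ℕ}
    (F : ℝ × EuclideanSpace ℝ (Fin n) →
      (EuclideanSpace ℝ (Fin n) →L[ℝ] EuclideanSpace ℝ (Fin n)))
    (hF : ContDiff ℝ 1 F)
    (V : EuclideanSpace ℝ (Fin n) × ℝ → ℝ)
    (hV : ContDiff ℝ 2 V) :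
    ContDiff ℝ 1 (Function.uncurry
      (fun (t : ℝ) (z : EuclideanSpace ℝ (Fin n) × EuclideanSpace ℝ (Fin n)) =>
        (z.2, F (t, z.1) z.2 - gradient (fun q => V (q, t)) z.1))) := by
  have hd : ContDiff ℝ 1 (fderiv ℝ V) := hV.fderiv_right (by norm_num)
  have h1 : ContDiff ℝ 1 (fun u : ℝ × (EuclideanSpace ℝ (Fin n) × EuclideanSpace ℝ (Fin n)) =>
      F (u.1, u.2.1) u.2.2) := by
    have : ContDiff ℝ 1 (fun u : ℝ × (EuclideanSpace ℝ (Fin n) × EuclideanSpace ℝ (Fin n)) =>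
      F (u.1, u.2.1)) := hF.comp (by fun_prop)
    exact this.clm_apply (by fun_prop)
  have h2 : ContDiff ℝ 1 (fun u : ℝ × (EuclideanSpace ℝ (Fin n) × EuclideanSpace ℝ (Fin n)) =>
      gradient (fun q => V (q, u.1)) u.2.1) := by
    simp only [gradient, cqp_fderiv_fst V hV]
    have h3 : ContDiff ℝ 1 (fun u : ℝ × (EuclideanSpace ℝ (Fin n) × EuclideanSpace ℝ (Fin n)) =>
      (fderiv ℝ V (u.2.1, u.1)).comp
        (ContinuousLinearMap.inl ℝ (EuclideanSpace ℝ (Fin n)) ℝ)) :=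
      (hd.comp (by fun_prop)).clm_comp contDiff_const
    exact (InnerProductSpace.toDual ℝ
      (EuclideanSpace ℝ (Fin n))).symm.toContinuousLinearEquiv.contDiff.comp h3
  have h4 : ContDiff ℝ 1 (fun u : ℝ × (EuclideanSpace ℝ (Fin n) × EuclideanSpace ℝ (Fin n)) =>
      u.2.2) := by fun_prop
  exact h4.prodMk (h1.sub h2)

open Set in
lemma cqp_apriori {n : ℕ}
    (F : ℝ × EuclideanSpace ℝ (Fin n) →
      (EuclideanSpace ℝ (Fin n) →L[ℝ] EuclideanSpace ℝ (Fin n)))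
    (V : EuclideanSpace ℝ (Fin n) × ℝ → ℝ)
    (hV : ContDiff ℝ 2 V) (T N A C : ℝ) (hT : 0 < T) (hN : 0 < N) (hA : 0 < A) (hC : 0 < C)
    (hyp : ∀ t ∈ Set.Icc (-T) T,
      ∀ p : EuclideanSpace ℝ (Fin n),
        ‖selfAdjointPart' (F (t, p))‖ ≤ N ∧
        -V (p, t) ≤ A * ‖p‖ ^ 2 + C ∧
        |deriv (fun s => V (p, s)) t| ≤ A * ‖p‖ ^ 2 + C)
    (x₀ : EuclideanSpace ℝ (Fin n) × EuclideanSpace ℝ (Fin n)) :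
    ∃ R : ℝ, ∀ (z : ℝ → EuclideanSpace ℝ (Fin n) × EuclideanSpace ℝ (Fin n)) (c : ℝ → ℝ),
      (∀ t, 0 ≤ c t ∧ c t ≤ 1) → z 0 = x₀ →
      (∀ t ∈ Icc (-T) T, HasDerivAt z (c t • ((z t).2,
        F (t, (z t).1) (z t).2 - gradient (fun q => V (q, t)) (z t).1)) t) →
      ∀ t ∈ Icc (-T) T, ‖z t‖ ≤ R := by
  set K : ℝ := 2 * N + 4 * A + C + 4 with hKdef
  let W : ℝ → EuclideanSpace ℝ (Fin n) × EuclideanSpace ℝ (Fin n) → ℝ := fun t z =>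
    2⁻¹ * ‖z.2‖ ^ 2 + V (z.1, t) + (A + 1) * ‖z.1‖ ^ 2 + C + 1
  have hWlow : ∀ t ∈ Icc (-T) T, ∀ z, 2⁻¹ * ‖z.2‖ ^ 2 + ‖z.1‖ ^ 2 + 1 ≤ W t z := by
    intro t ht z
    have := (hyp t ht z.1).2.1
    simp only [W]
    linarith
  refine ⟨2 * (W 0 x₀ * Real.exp (K * T)) + 1, ?_⟩
  intro z c hc hz0 hz
  have hx : ∀ t ∈ Icc (-T) T, HasDerivAt (fun s => (z s).1) (c t • (z t).2) t := by
    intro t ht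
    exact (hasFDerivAt_fst (p := z t)).comp_hasDerivAt t (hz t ht)
  have hy : ∀ t ∈ Icc (-T) T, HasDerivAt (fun s => (z s).2)
      (c t • (F (t, (z t).1) (z t).2 - gradient (fun q => V (q, t)) (z t).1)) t := by
    intro t ht
    exact (hasFDerivAt_snd (p := z t)).comp_hasDerivAt t (hz t ht)
  have hWd : ∀ t ∈ Icc (-T) T, HasDerivAt (fun s => W s (z s))
      (c t * inner ℝ (z t).2 (F (t, (z t).1) (z t).2) + deriv (fun s => V ((z t).1, s)) t
        + 2 * (A + 1) * c t * inner ℝ (z t).1 (z t).2) t := by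
    intro t ht
    have h1 := (hy t ht).norm_sq
    have h2 := (hx t ht).norm_sq
    have h3 : HasDerivAt (fun s => V ((z s).1, s)) (fderiv ℝ V ((z t).1, t) (c t • (z t).2, 1)) t :=
      HasFDerivAt.comp_hasDerivAt (f := fun s => ((z s).1, s)) t
        ((hV.differentiable two_ne_zero ((z t).1, t)).hasFDerivAt)
        ((hx t ht).prodMk (hasDerivAt_id t))
    have h4 := ((((h1.const_mul 2⁻¹).add h3).add (h2.const_mul (A + 1))).add_const C).add_const 1
    refine h4.congr_deriv ?_
    have e1 : ((c t • (z t).2, 1) : EuclideanSpace ℝ (Fin n) × ℝ) =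
        c t • ((z t).2, (0:ℝ)) + ((0 : EuclideanSpace ℝ (Fin n)), (1:ℝ)) := by simp
    rw [e1, map_add, map_smul, ← cqp_grad_inner V hV, ← cqp_deriv_snd V hV, inner_smul_right,
      inner_smul_right, inner_sub_right,
      real_inner_comm (z t).2 (gradient (fun q => V (q, t)) (z t).1), smul_eq_mul]
    ring
  have hgr := cqp_gronwall _ _ K T (by positivity) hWd ?_ ?_
  · intro t ht
    have h1 := hgr t ht
    have h2 := hWlow t ht (z t)
    simp only [hz0] at h1
    rw [Prod.norm_def]
    apply max_le
    · nlinarith [sq_nonneg (‖(z t).1‖ - 1), sq_nonneg (‖(z t).2‖)]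
    · nlinarith [sq_nonneg (‖(z t).2‖ - 1), sq_nonneg (‖(z t).1‖)]
  · intro t ht
    have h1 := hWlow t ht (z t)
    obtain ⟨hS, -, h2⟩ := hyp t ht (z t).1
    have h3 := cqp_selfAdj _ _ hS (z t).2
    have h4 := abs_real_inner_le_norm (z t).1 (z t).2
    obtain ⟨c0, c1⟩ := hc t
    have a1 : |c t * inner ℝ (z t).2 (F (t, (z t).1) (z t).2)| ≤ N * ‖(z t).2‖ ^ 2 := by
      rw [abs_mul, abs_of_nonneg c0]
      exact (mul_le_of_le_one_left (abs_nonneg _) c1).trans h3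
    have a2 : |2 * (A + 1) * c t * inner ℝ (z t).1 (z t).2|
        ≤ (A + 1) * (‖(z t).1‖ ^ 2 + ‖(z t).2‖ ^ 2) := by
      have : |2 * (A + 1) * c t * inner ℝ (z t).1 (z t).2|
          = (A + 1) * (2 * (c t * |inner ℝ (z t).1 (z t).2|)) := by
        rw [abs_mul, abs_mul, abs_of_nonneg c0, abs_of_nonneg (by positivity : 0 ≤ 2 * (A + 1))]
        ring
      rw [this]
      have h5 := mul_le_of_le_one_left (abs_nonneg (inner ℝ (z t).1 (z t).2)) c1
      gcongr
      nlinarith [sq_nonneg (‖(z t).1‖ - ‖(z t).2‖)]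
    have hK0 : 0 ≤ K := by positivity
    refine (abs_add_three _ _ _).trans ?_
    refine le_trans ?_ (mul_le_mul_of_nonneg_left h1 hK0)
    rw [hKdef]
    have q1 := sq_nonneg ‖(z t).1‖
    have q2 := sq_nonneg ‖(z t).2‖
    nlinarith [mul_nonneg hN.le q1, mul_nonneg hA.le q1, mul_nonneg hC.le q1,
      mul_nonneg hN.le q2, mul_nonneg hA.le q2, mul_nonneg hC.le q2]
  · intro t ht
    have := hWlow t ht (z t)
    exact le_trans (by positivity) this

/-- Theorem 3 on `ℝⁿ`: if the self-adjoint part of `F` is bounded along finite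
times and both `−V` and `|∂V/∂t|` grow at most quadratically along finite
times, then every inextensible solution of `γ'' = F(t,γ)(γ') − ∇ᴹV(γ,t)` is
complete. -/
theorem completeness_quadratic_potential {n : ℕ}
    (F : ℝ × EuclideanSpace ℝ (Fin n) →
      (EuclideanSpace ℝ (Fin n) →L[ℝ] EuclideanSpace ℝ (Fin n)))
    (hF : ContDiff ℝ 1 F)
    (V : EuclideanSpace ℝ (Fin n) × ℝ → ℝ)
    (hV : ContDiff ℝ 2 V)
    (hyp : ∀ T > 0, ∃ N > 0, ∃ A > 0, ∃ C > 0, ∀ t ∈ Set.Icc (-T) T,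
      ∀ p : EuclideanSpace ℝ (Fin n),
        ‖selfAdjointPart' (F (t, p))‖ ≤ N ∧
        -V (p, t) ≤ A * ‖p‖ ^ 2 + C ∧
        |deriv (fun s => V (p, s)) t| ≤ A * ‖p‖ ^ 2 + C) :
    ∀ p v : EuclideanSpace ℝ (Fin n),
      ∃ γ : ℝ → EuclideanSpace ℝ (Fin n), ContDiff ℝ 2 γ ∧
        γ 0 = p ∧ deriv γ 0 = v ∧
        ∀ t : ℝ, deriv (deriv γ) t
          = F (t, γ t) (deriv γ t) - gradient (fun q => V (q, t)) (γ t) := by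
  intro p v
  have hap : ∀ T > 0, ∃ R : ℝ,
      ∀ (z : ℝ → EuclideanSpace ℝ (Fin n) × EuclideanSpace ℝ (Fin n)) (c : ℝ → ℝ),
      (∀ t, 0 ≤ c t ∧ c t ≤ 1) → z 0 = (p, v) →
      (∀ t ∈ Set.Icc (-T) T, HasDerivAt z (c t • ((z t).2,
        F (t, (z t).1) (z t).2 - gradient (fun q => V (q, t)) (z t).1)) t) →
      ∀ t ∈ Set.Icc (-T) T, ‖z t‖ ≤ R := by
    intro T hT
    obtain ⟨N, hN, A, hA, C, hC, h⟩ := hyp T hT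
    exact cqp_apriori F V hV T N A C hT hN hA hC h (p, v)
  have hfc := cqp_field_contDiff F hF V hV
  obtain ⟨z, hz0, hz⟩ := cqp_global _ hfc (p, v) hap
  have hx : ∀ t, HasDerivAt (fun s => (z s).1) (z t).2 t := fun t =>
    (hasFDerivAt_fst (p := z t)).comp_hasDerivAt t (hz t)
  have hy : ∀ t, HasDerivAt (fun s => (z s).2)
      (F (t, (z t).1) (z t).2 - gradient (fun q => V (q, t)) (z t).1) t := fun t =>
    (hasFDerivAt_snd (p := z t)).comp_hasDerivAt t (hz t)
  have dx : deriv (fun s => (z s).1) = fun s => (z s).2 := funext fun t => (hx t).deriv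
  have cz : Continuous z := continuous_iff_continuousAt.mpr fun t => (hz t).continuousAt
  have dz : deriv z = fun t => ((z t).2,
      F (t, (z t).1) (z t).2 - gradient (fun q => V (q, t)) (z t).1) :=
    funext fun t => (hz t).deriv
  have c1 : ContDiff ℝ 1 z := by
    rw [contDiff_one_iff_deriv]
    refine ⟨fun t => (hz t).differentiableAt, ?_⟩
    rw [dz]
    exact hfc.continuous.comp (continuous_id.prodMk cz)
  refine ⟨fun s => (z s).1, ?_, by simp [hz0], by rw [dx]; simp [hz0], fun t => ?_⟩
  · rw [show (2 : WithTop ℕ∞) = 1 + 1 by norm_num, contDiff_succ_iff_deriv]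
    refine ⟨fun t => (hx t).differentiableAt, by simp, ?_⟩
    rw [dx]
    exact contDiff_snd.comp c1
  · rw [dx]
    exact (hy t).deriv
end

section
/- Let η be the Minkowski bilinear form on ℝ^{n+1}, defined by η(v, w) = −v₀ w₀ + Σ_{i=1}^{n} vᵢ wᵢ, and let e₀ = (1, 0, …, 0). Let V : ℝ^{n+1} → ℝ be smooth and ℤ^{n+1}-periodic, let W : ℝ^{n+1} → ℝ^{n+1} be its η-gradient, i.e. η(W(p), w) = dV_p(w) for all p, w, and let F : ℝ^{n+1} → (ℝ^{n+1} →L ℝ^{n+1}) be smooth and ℤ^{n+1}-periodic with each F(p) η-skew-adjoint (η(F(p)v, w) = −η(v, F(p)w) for all v, w) and F(p) e₀ = 0 for all p. Then for every (p, v) ∈ ℝ^{n+1} × ℝ^{n+1} there exists a twice continuously differentiable curve γ : ℝ → ℝ^{n+1} with γ(0) = p, γ'(0) = v, and γ''(t) = F(γ(t))(γ'(t)) − W(γ(t)) for all t ∈ ℝ. -/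
/-- The Minkowski bilinear form on `ℝ^{n+1}`:
`η(v, w) = −v₀w₀ + Σ_{i=1}^{n} vᵢwᵢ`. -/
noncomputable def minkowski {n : ℕ} (v w : Fin (n + 1) → ℝ) : ℝ :=
  -(v 0 * w 0) + ∑ i : Fin n, v i.succ * w i.succ

/-- The vector `e₀ = (1, 0, …, 0)` of `ℝ^{n+1}`. -/
noncomputable def e₀ {n : ℕ} : Fin (n + 1) → ℝ :=
  fun i => if i = 0 then 1 else 0

open Set Metric in
/-- Integral curves of a bounded Lipschitz field exist on any interval `[-a, a]`. -/
lemma exists_curve_of_bounded {E : Type*} [NormedAddCommGroup E] [NormedSpace ℝ E]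
    [CompleteSpace E] (w : E → E) (K : NNReal) (hK : LipschitzWith K w) (L : ℝ)
    (hL : ∀ x, ‖w x‖ ≤ L) (x : E) (a : ℝ) (ha : 0 ≤ a) :
    ∃ γ : ℝ → E, γ 0 = x ∧ ∀ t ∈ Icc (-a) a, HasDerivWithinAt γ (w (γ t)) (Icc (-a) a) t := by
  have hL0 : 0 ≤ L := (norm_nonneg _).trans (hL x)
  have h0 : (0 : ℝ) ∈ Icc (-a) a := ⟨by linarith, ha⟩
  have hpl : IsPicardLindelof (fun _ => w) (⟨0, h0⟩ : Icc (-a) a) x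
      (⟨L * a, by positivity⟩ : NNReal) 0 (⟨L, hL0⟩ : NNReal) K := by
    refine IsPicardLindelof.of_time_independent (fun y _ => hL y) hK.lipschitzOnWith ?_
    simp
    exact le_refl (L * a)
  exact hpl.exists_eq_forall_mem_Icc_hasDerivWithinAt₀

open Set Metric in
/-- Grönwall bound for curves on `[-a, a]` under linear growth. -/
lemma curve_bound {E : Type*} [NormedAddCommGroup E] [NormedSpace ℝ E]
    (w : E → E) (A B : ℝ) (hA : 0 ≤ A) (hB : 0 ≤ B)
    (hw : ∀ x, ‖w x‖ ≤ A * ‖x‖ + B) (γ : ℝ → E) (a : ℝ)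
    (hγ : ∀ t ∈ Icc (-a) a, HasDerivWithinAt γ (w (γ t)) (Icc (-a) a) t) :
    ∀ t ∈ Icc (-a) a, ‖γ t‖ ≤ gronwallBound ‖γ 0‖ A B a := by
  have hmono := gronwallBound_mono (norm_nonneg (γ 0)) hB hA
  have key : ∀ (σ : ℝ → E) (u : E → E), (∀ x, ‖u x‖ ≤ A * ‖x‖ + B) → σ 0 = γ 0 →
      (∀ t ∈ Icc (-a) a, HasDerivWithinAt σ (u (σ t)) (Icc (-a) a) t) →
      ∀ t ∈ Icc 0 a, ‖σ t‖ ≤ gronwallBound ‖γ 0‖ A B a := by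
    intro σ u hu h0 hσ t ht
    have h1 := norm_le_gronwallBound_of_norm_deriv_right_le (f := σ) (f' := fun t => u (σ t))
      (δ := ‖γ 0‖) (K := A) (ε := B) (a := 0) (b := a) ?_ ?_ (by rw [h0]) ?_ t ht
    · exact h1.trans (hmono (by simpa using ht.2))
    · intro s hs
      exact ((hσ s ⟨by linarith [hs.1, hs.2], hs.2⟩).continuousWithinAt).mono
        (Icc_subset_Icc_left (by linarith [hs.1, hs.2]))
    · intro s hs
      refine (hσ s ⟨by linarith [hs.1, hs.2], hs.2.le⟩).mono_of_mem_nhdsWithin ?_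
      exact Filter.mem_of_superset (Icc_mem_nhdsGE hs.2)
        (Icc_subset_Icc_left (by linarith [hs.1, hs.2]))
    · intro s _
      exact hu _
  intro t ht
  rcases le_total 0 t with h | h
  · exact key γ w hw rfl hγ t ⟨h, ht.2⟩
  · have := key (fun s => γ (-s)) (fun x => - w x) (by simpa using hw) (by simp) ?_ (-t)
      ⟨by linarith, by linarith [ht.1]⟩
    · simpa using this
    · intro s hs
      have h2 := (hγ (-s) ⟨by linarith [hs.2], by linarith [hs.1]⟩).scomp s
        ((hasDerivAt_neg s).hasDerivWithinAt (s := Icc (-a) a))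
        (fun r hr => ⟨by linarith [hr.2], by linarith [hr.1]⟩)
      simpa [Function.comp_def] using h2

open Set Metric Manifold in
/-- A `C¹` vector field of linear growth is complete. -/
lemma exists_global_curve {E : Type*} [NormedAddCommGroup E] [NormedSpace ℝ E]
    [FiniteDimensional ℝ E] (G : E → E) (hG : ContDiff ℝ 1 G) (A B : ℝ) (hA : 0 ≤ A)
    (hB : 0 ≤ B) (hw : ∀ x, ‖G x‖ ≤ A * ‖x‖ + B) (x : E) :
    ∃ γ : ℝ → E, γ 0 = x ∧ ∀ t, HasDerivAt γ (G (γ t)) t := by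
  have : CompleteSpace E := FiniteDimensional.complete ℝ E
  have hloc : ∀ a : ℝ, ∃ γ : ℝ → E, γ 0 = x ∧
      ∀ t ∈ Ioo (-a) a, HasDerivAt γ (G (γ t)) t := by
    intro a
    rcases lt_or_ge a 0 with ha | ha
    · exact ⟨fun _ => x, rfl, fun t ht => by linarith [ht.1, ht.2]⟩
    set R := gronwallBound ‖x‖ A B a with hR
    let χ : ContDiffBump (0 : E) := ⟨|R| + 1, |R| + 2, by positivity, by linarith⟩
    have hsupp : HasCompactSupport (fun y => χ y • G y) := χ.hasCompactSupport.smul_right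
    have hsm : ContDiff ℝ 1 (fun y => χ y • G y) := (χ.contDiff (n := 1)).smul hG
    obtain ⟨K, hK⟩ := ContDiff.lipschitzWith_of_hasCompactSupport hsupp hsm (by simp)
    obtain ⟨L, hL⟩ := hsm.continuous.bounded_above_of_compact_support hsupp
    obtain ⟨γ, h0, hγ⟩ := exists_curve_of_bounded _ K hK L hL x a ha
    have hgr : ∀ y, ‖χ y • G y‖ ≤ A * ‖y‖ + B := by
      intro y
      rw [norm_smul, Real.norm_of_nonneg χ.nonneg]
      exact (mul_le_of_le_one_left (norm_nonneg _) χ.le_one).trans (hw y)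
    have hb := curve_bound _ A B hA hB hgr γ a hγ
    refine ⟨γ, h0, fun t ht => ?_⟩
    have h3 := (hγ t (Ioo_subset_Icc_self ht)).hasDerivAt (Icc_mem_nhds ht.1 ht.2)
    have h4 : χ (γ t) = 1 := by
      apply χ.one_of_mem_closedBall
      rw [mem_closedBall_zero_iff]
      have := hb t (Ioo_subset_Icc_self ht)
      rw [h0, ← hR] at this
      change _ ≤ |R| + 1
      linarith [le_abs_self R]
    simpa [h4] using h3
  have hv : ContMDiff 𝓘(ℝ, E) 𝓘(ℝ, E).tangent 1
      (fun y => (⟨y, G y⟩ : TangentBundle 𝓘(ℝ, E) E)) :=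
    contMDiff_vectorSpace_iff_contDiff.2 hG
  obtain ⟨γ, h0, hγ⟩ := (exists_isMIntegralCurve_iff_exists_isMIntegralCurveOn_Ioo
    (I := 𝓘(ℝ, E)) (v := G) hv x).2 (fun a => by
      obtain ⟨γ, h0, hγ⟩ := hloc a
      exact ⟨γ, h0, fun t ht => (hγ t ht).hasFDerivAt.hasMFDerivAt.hasMFDerivWithinAt⟩)
  exact ⟨γ, h0, fun t => by
    have h : HasFDerivAt γ ((1 : ℝ →L[ℝ] ℝ).smulRight (G (γ t))) t := (hγ t).hasFDerivAt
    simpa using h.hasDerivAt⟩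

/-- A continuous periodic function is bounded. -/
lemma bounded_of_periodic {m : ℕ} {X : Type*} [NormedAddCommGroup X] (f : (Fin m → ℝ) → X)
    (hf : Continuous f)
    (hper : ∀ (p : Fin m → ℝ) (k : Fin m → ℤ), f (p + fun i => (k i : ℝ)) = f p) :
    ∃ C : ℝ, 0 ≤ C ∧ ∀ p, ‖f p‖ ≤ C := by
  obtain ⟨C, hC⟩ := (isCompact_Icc (a := (0 : Fin m → ℝ)) (b := 1)).exists_bound_of_continuousOn
    hf.continuousOn
  refine ⟨C, (norm_nonneg _).trans (hC 0 ⟨le_rfl, zero_le_one⟩), fun p => ?_⟩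
  have h1 := hper (fun i => Int.fract (p i)) (fun i => ⌊p i⌋)
  have h2 : ((fun i => Int.fract (p i)) + fun i => ((⌊p i⌋ : ℤ) : ℝ)) = p := by
    funext i
    simp
  rw [h2] at h1
  rw [h1]
  exact hC _ ⟨fun i => Int.fract_nonneg _, fun i => (Int.fract_lt_one _).le⟩

/-- Theorem 1 on the flat Lorentzian torus `ℝ^{n+1}/ℤ^{n+1}`: if `V` is smooth
`ℤ^{n+1}`-periodic with `η`-gradient `W`, and `F` is smooth, `ℤ^{n+1}`-periodic,
`η`-skew-adjoint with `F(p)e₀ = 0` (where the constant field `K = e₀` is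
timelike and Killing), then every inextensible solution of
`γ'' = F(γ)(γ') − W(γ)` is complete: for every initial condition there is a
globally defined solution. -/
theorem completeness_lorentzian_torus {n : ℕ}
    (V : (Fin (n + 1) → ℝ) → ℝ) (hV : ContDiff ℝ (⊤ : ℕ∞) V)
    (hVper : ∀ (p : Fin (n + 1) → ℝ) (k : Fin (n + 1) → ℤ),
      V (p + fun i => (k i : ℝ)) = V p)
    (W : (Fin (n + 1) → ℝ) → (Fin (n + 1) → ℝ))
    (hW : ∀ p w : Fin (n + 1) → ℝ, minkowski (W p) w = fderiv ℝ V p w)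
    (F : (Fin (n + 1) → ℝ) → ((Fin (n + 1) → ℝ) →L[ℝ] (Fin (n + 1) → ℝ)))
    (hF : ContDiff ℝ (⊤ : ℕ∞) F)
    (hFper : ∀ (p : Fin (n + 1) → ℝ) (k : Fin (n + 1) → ℤ),
      F (p + fun i => (k i : ℝ)) = F p)
    (hFskew : ∀ p v w : Fin (n + 1) → ℝ,
      minkowski (F p v) w = - minkowski v (F p w))
    (hFe₀ : ∀ p : Fin (n + 1) → ℝ, F p e₀ = 0) :
    ∀ p v : Fin (n + 1) → ℝ,
      ∃ γ : ℝ → (Fin (n + 1) → ℝ), ContDiff ℝ 2 γ ∧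
        γ 0 = p ∧ deriv γ 0 = v ∧
        ∀ t : ℝ, deriv (deriv γ) t = F (γ t) (deriv γ t) - W (γ t) := by
  have hW0 : ∀ p, W p 0 = - fderiv ℝ V p (Pi.single 0 1) := by
    intro p
    rw [← hW]
    simp [minkowski]
  have hWs : ∀ p (i : Fin n), W p i.succ = fderiv ℝ V p (Pi.single i.succ 1) := by
    intro p i
    rw [← hW]
    simp [minkowski, Pi.single_apply]
  have hdV : ContDiff ℝ 1 (fderiv ℝ V) :=
    hV.fderiv_right (m := 1) (WithTop.coe_le_coe.2 (le_top : (1 + 1 : ℕ∞) ≤ ⊤))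
  have hWc : ContDiff ℝ 1 W := by
    rw [contDiff_pi]
    intro i
    refine Fin.cases ?_ (fun j => ?_) i
    · simp only [hW0]
      exact (hdV.clm_apply contDiff_const).neg
    · simp only [hWs]
      exact hdV.clm_apply contDiff_const
  have hdper : ∀ (p : Fin (n + 1) → ℝ) (k : Fin (n + 1) → ℤ),
      fderiv ℝ V (p + fun i => (k i : ℝ)) = fderiv ℝ V p := by
    intro p k
    rw [← fderiv_comp_add_right]
    simp only [hVper]
  have hWper : ∀ (p : Fin (n + 1) → ℝ) (k : Fin (n + 1) → ℤ),
      W (p + fun i => (k i : ℝ)) = W p := by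
    intro p k
    funext i
    refine Fin.cases ?_ (fun j => ?_) i
    · rw [hW0, hW0, hdper]
    · rw [hWs, hWs, hdper]
  obtain ⟨CF, hCF0, hCF⟩ := bounded_of_periodic F hF.continuous hFper
  obtain ⟨CW, hCW0, hCW⟩ := bounded_of_periodic W hWc.continuous hWper
  have hF1 : ContDiff ℝ 1 F := hF.of_le (by exact_mod_cast le_top)
  intro p v
  have hacc : ContDiff ℝ 1
      (fun z : (Fin (n + 1) → ℝ) × (Fin (n + 1) → ℝ) => F z.1 z.2 - W z.1) :=
    ((hF1.comp contDiff_fst).clm_apply contDiff_snd).sub (hWc.comp contDiff_fst)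
  obtain ⟨Γ, hΓ0, hΓ⟩ := exists_global_curve
    (fun z : (Fin (n + 1) → ℝ) × (Fin (n + 1) → ℝ) => (z.2, F z.1 z.2 - W z.1))
    (contDiff_snd.prodMk hacc) (1 + CF) CW (by positivity) hCW0 (by
      intro z
      have hz2 : ‖z.2‖ ≤ ‖z‖ := norm_snd_le z
      have hz := norm_nonneg z
      rw [Prod.norm_def]
      refine max_le ?_ ?_
      · dsimp only
        nlinarith
      · have h1 : ‖F z.1 z.2‖ ≤ CF * ‖z‖ :=
          ((F z.1).le_opNorm z.2).trans
            (mul_le_mul (hCF _) hz2 (norm_nonneg _) hCF0)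
        have h2 := norm_sub_le (F z.1 z.2) (W z.1)
        have h3 := hCW z.1
        dsimp only
        nlinarith) (p, v)
  have h1 : ∀ t, HasDerivAt (fun s => (Γ s).1) (Γ t).2 t := fun t =>
    (hasFDerivAt_fst (𝕜 := ℝ) (p := Γ t)).comp_hasDerivAt t (hΓ t)
  have h2 : ∀ t, HasDerivAt (fun s => (Γ s).2) (F (Γ t).1 (Γ t).2 - W (Γ t).1) t := fun t =>
    (hasFDerivAt_snd (𝕜 := ℝ) (p := Γ t)).comp_hasDerivAt t (hΓ t)
  have hd1 : deriv (fun s => (Γ s).1) = fun s => (Γ s).2 := funext fun t => (h1 t).deriv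
  have hd2 : deriv (fun s => (Γ s).2) = fun s => F (Γ s).1 (Γ s).2 - W (Γ s).1 :=
    funext fun t => (h2 t).deriv
  have hΓc : Continuous Γ :=
    continuous_iff_continuousAt.2 fun t => (hΓ t).continuousAt
  refine ⟨fun s => (Γ s).1, ?_, by simp [hΓ0], by simp [hd1, hΓ0], fun t => ?_⟩
  · have : ContDiff ℝ (1 + 1) (fun s => (Γ s).1) := by
      rw [contDiff_succ_iff_deriv]
      refine ⟨fun t => (h1 t).differentiableAt, by simp, ?_⟩
      rw [hd1, contDiff_one_iff_deriv]
      refine ⟨fun t => (h2 t).differentiableAt, ?_⟩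
      rw [hd2]
      exact hacc.continuous.comp hΓc
    simpa [one_add_one_eq_two] using this
  · rw [hd1, hd2]
end

section
/- Let η be the Minkowski bilinear form on ℝ^{n+1}, defined by η(v, w) = −v₀ w₀ + Σ_{i=1}^{n} vᵢ wᵢ, and let e₀ = (1, 0, …, 0). Let V : ℝ^{n+1} → ℝ be smooth and ℤ^{n+1}-periodic, let W : ℝ^{n+1} → ℝ^{n+1} be its η-gradient (η(W(p), w) = dV_p(w) for all p, w), and let F : ℝ^{n+1} → (ℝ^{n+1} →L ℝ^{n+1}) be smooth with each F(p) η-skew-adjoint and F(p) e₀ = 0 for all p. If γ : [0, b) → ℝ^{n+1}, with 0 < b < +∞, is twice differentiable and satisfies γ''(t) = F(γ(t))(γ'(t)) − W(γ(t)) for all t ∈ [0, b), then the function t ↦ η(e₀, γ'(t)) is bounded on [0, b). -/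
/-- The key estimate in the proof of Theorem 1, on Minkowski space with
Killing field `K = e₀`: along a solution of `γ'' = F(γ)(γ') − W(γ)` on a
finite interval `[0, b)`, with `F` `η`-skew-adjoint, `F(p)e₀ = 0`, and `W` the
`η`-gradient of a smooth `ℤ^{n+1}`-periodic potential `V`, the function
`t ↦ η(e₀, γ'(t))` is bounded. -/
theorem bounded_killing_momentum {n : ℕ}
    (V : (Fin (n + 1) → ℝ) → ℝ) (hV : ContDiff ℝ (⊤ : ℕ∞) V)
    (hVper : ∀ (p : Fin (n + 1) → ℝ) (k : Fin (n + 1) → ℤ),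
      V (p + fun i => (k i : ℝ)) = V p)
    (W : (Fin (n + 1) → ℝ) → (Fin (n + 1) → ℝ))
    (hW : ∀ p w : Fin (n + 1) → ℝ, minkowski (W p) w = fderiv ℝ V p w)
    (F : (Fin (n + 1) → ℝ) → ((Fin (n + 1) → ℝ) →L[ℝ] (Fin (n + 1) → ℝ)))
    (hF : ContDiff ℝ (⊤ : ℕ∞) F)
    (hFskew : ∀ p v w : Fin (n + 1) → ℝ,
      minkowski (F p v) w = - minkowski v (F p w))
    (hFe₀ : ∀ p : Fin (n + 1) → ℝ, F p e₀ = 0)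
    (b : ℝ) (hb : 0 < b)
    (γ γ' γ'' : ℝ → (Fin (n + 1) → ℝ))
    (hγ : ∀ t ∈ Set.Ico 0 b, HasDerivWithinAt γ (γ' t) (Set.Ico 0 b) t)
    (hγ' : ∀ t ∈ Set.Ico 0 b, HasDerivWithinAt γ' (γ'' t) (Set.Ico 0 b) t)
    (heq : ∀ t ∈ Set.Ico 0 b, γ'' t = F (γ t) (γ' t) - W (γ t)) :
    ∃ C : ℝ, ∀ t ∈ Set.Ico 0 b, |minkowski e₀ (γ' t)| ≤ C := by
  have hm : ∀ v : Fin (n + 1) → ℝ, minkowski e₀ v = - v 0 := by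
    intro v; simp [minkowski, e₀, Fin.succ_ne_zero]
  have hm' : ∀ v : Fin (n + 1) → ℝ, minkowski v e₀ = - v 0 := by
    intro v; simp [minkowski, e₀, Fin.succ_ne_zero]
  have hF0 : ∀ p v, (F p v) 0 = 0 := by
    intro p v
    have h := hFskew p v e₀
    rw [hFe₀, hm'] at h
    simpa [minkowski] using h
  have hW0 : ∀ p, (W p) 0 = - fderiv ℝ V p e₀ := by
    intro p
    have h := hW p e₀
    rw [hm'] at h
    linarith
  have hcont : Continuous (fun p => fderiv ℝ V p e₀) :=
    (hV.continuous_fderiv (by simp)).clm_apply continuous_const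
  have hper : ∀ (p : Fin (n + 1) → ℝ) (k : Fin (n + 1) → ℤ),
      fderiv ℝ V (p + fun i => (k i : ℝ)) = fderiv ℝ V p := by
    intro p k
    rw [← fderiv_comp_add_right]
    congr 1
    funext q
    exact hVper q k
  obtain ⟨M, hM⟩ := (isCompact_Icc (a := (0 : Fin (n + 1) → ℝ)) (b := 1)).exists_bound_of_continuousOn
    hcont.continuousOn
  have hbd : ∀ p, ‖fderiv ℝ V p e₀‖ ≤ M := by
    intro p
    have h1 := hM (fun i => Int.fract (p i))
      ⟨fun i => Int.fract_nonneg _, fun i => (Int.fract_lt_one _).le⟩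
    have h2 := hper (fun i => Int.fract (p i)) (fun i => ⌊p i⌋)
    have h3 : ((fun i => Int.fract (p i)) + fun i => ((⌊p i⌋ : ℤ) : ℝ)) = p := by
      funext i; simp
    rw [h3] at h2
    rw [h2]; exact h1
  have hM0 : 0 ≤ M := (norm_nonneg _).trans (hbd 0)
  have hd : ∀ t ∈ Set.Ico 0 b,
      HasDerivWithinAt (fun s => γ' s 0) (γ'' t 0) (Set.Ico 0 b) t :=
    fun t ht => (hasDerivWithinAt_pi.1 (hγ' t ht)) 0
  have hb2 : ∀ t ∈ Set.Ico 0 b, ‖γ'' t 0‖ ≤ M := by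
    intro t ht
    rw [heq t ht, Pi.sub_apply, hF0, hW0]
    simpa using hbd (γ t)
  refine ⟨|γ' 0 0| + M * b, fun t ht => ?_⟩
  have h := (convex_Ico (0 : ℝ) b).norm_image_sub_le_of_norm_hasDerivWithin_le hd hb2
    (Set.left_mem_Ico.2 hb) ht
  rw [hm, abs_neg]
  simp only [sub_zero, Real.norm_eq_abs] at h
  rw [abs_of_nonneg ht.1] at h
  have h4 : M * t ≤ M * b := mul_le_mul_of_nonneg_left ht.2.le hM0
  have h5 := abs_sub_abs_le_abs_sub (γ' t 0) (γ' 0 0)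
  linarith
end

section
/- There is no twice differentiable function f : ℝ → ℝ satisfying f''(t) = 2 f(t)³ for all t ∈ ℝ together with f(0) = 1 and f'(0) = 1. -/
lemma linear_ode_zero (a u : ℝ → ℝ) (ha : Continuous a)
    (hu : ∀ t, HasDerivAt u (a t * u t) t) (h0 : u 0 = 0) (t : ℝ) : u t = 0 := by
  have hI : ∀ t, HasDerivAt (fun s => ∫ x in (0:ℝ)..s, a x) (a t) t := fun t =>
    ha.integral_hasStrictDerivAt 0 t |>.hasDerivAt
  have hG : ∀ t, HasDerivAt (fun s => u s * Real.exp (-∫ x in (0:ℝ)..s, a x)) 0 t := by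
    intro t
    have h := (hu t).mul (hI t).neg.exp
    refine h.congr_deriv ?_
    simp only [Pi.neg_apply]
    ring
  have hc := is_const_of_deriv_eq_zero (fun t => (hG t).differentiableAt)
    (fun t => (hG t).deriv) t 0
  simp only [h0, zero_mul] at hc
  exact (mul_eq_zero.mp hc).resolve_right (Real.exp_pos _).ne'

/-- The incompleteness assertion of Example 1(2): there is no globally defined
twice differentiable `f : ℝ → ℝ` with `f'' = 2f³`, `f(0) = 1`, `f'(0) = 1`. -/
theorem example_no_global_solution :
    ¬ ∃ f f' f'' : ℝ → ℝ,
      (∀ t : ℝ, HasDerivAt f (f' t) t) ∧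
      (∀ t : ℝ, HasDerivAt f' (f'' t) t) ∧
      (∀ t : ℝ, f'' t = 2 * f t ^ 3) ∧
      f 0 = 1 ∧ f' 0 = 1 := by
  rintro ⟨f, f', f'', h1, h2, h3, h4, h5⟩
  have hf : Continuous f := continuous_iff_continuousAt.2 fun t => (h1 t).continuousAt
  have key : ∀ t, f' t - f t ^ 2 = 0 := by
    refine linear_ode_zero (fun t => -2 * f t) (fun t => f' t - f t ^ 2) (by fun_prop) ?_ ?_
    · intro t
      refine ((h2 t).sub ((h1 t).pow 2)).congr_deriv ?_
      rw [h3]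
      push_cast
      ring
    · simp [h4, h5]
  have key2 : ∀ t, f t * (1 - t) - 1 = 0 := by
    refine linear_ode_zero f (fun t => f t * (1 - t) - 1) hf ?_ ?_
    · intro t
      refine (((h1 t).mul ((hasDerivAt_id t).const_sub 1)).sub_const 1).congr_deriv ?_
      have := key t
      simp only [id]
      linear_combination (1 - t) * this
    · simp [h4]
  have := key2 1
  norm_num at this
end
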